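/- arXiv:1603.04950 — 2 statements merged into one kernel-verified Lean document; each statement's English description precedes it below -/
import Mathlib

section
/- Let F ∈ ℂ^{2n×2n}, G ∈ ℂ^{2n×2m}, H ∈ ℂ^{2m×2n}, K ∈ ℂ^{2m×2m} be a minimal realization, i.e. rank[G, FG, …, F^{2n−1}G] = 2n and rank[H; HF; …; HF^{2n−1}] = 2n. Then the transfer function Γ(s) = H(sI − F)^{−1}G + K is dual (J,J)-unitary if and only if K J_m K† = J_m and there exists a Hermitian matrix Θ ∈ ℂ^{2n×2n} such that FΘ + ΘF† + G J_m G† = 0 and K J_m G† + HΘ = 0. -/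
open Matrix

noncomputable section

/-- `J_k = [[I, 0],[0, −I]]`. -/
def Jmat (k : ℕ) : Matrix (Fin k ⊕ Fin k) (Fin k ⊕ Fin k) ℂ :=
  Matrix.fromBlocks 1 0 0 (-1)

/-- The horizontally concatenated controllability matrix `[G, FG, …, F^{k−1}G]`. -/
def ctrbMat {N M : Type*} [Fintype N] [DecidableEq N]
    (F : Matrix N N ℂ) (G : Matrix N M ℂ) (k : ℕ) : Matrix N (Fin k × M) ℂ :=
  Matrix.of fun i p => (F ^ (p.1 : ℕ) * G) i p.2

/-- The vertically concatenated observability matrix `[H; HF; …; HF^{k−1}]`. -/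
def obsvMat {N M : Type*} [Fintype N] [DecidableEq N]
    (F : Matrix N N ℂ) (H : Matrix M N ℂ) (k : ℕ) : Matrix (Fin k × M) N ℂ :=
  Matrix.of fun p j => (H * F ^ (p.1 : ℕ)) p.2 j

/-- The transfer function `Γ(s) = H (sI − F)⁻¹ G + K`. -/
def transferFn {N M P : Type*} [Fintype N] [DecidableEq N]
    (F : Matrix N N ℂ) (G : Matrix N M ℂ) (H : Matrix P N ℂ) (K : Matrix P M ℂ)
    (s : ℂ) : Matrix P M ℂ :=
  H * (s • (1 : Matrix N N ℂ) - F)⁻¹ * G + K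

/-- `Γ` is dual `(J,J)`-unitary: `Γ(s) J_m Γ(−s̄)† = J_m` for all `s` with `Re s ≥ 0`
such that both `sI − F` and `−s̄I − F` are invertible. -/
def DualJJUnitary {n m : ℕ}
    (F : Matrix (Fin n ⊕ Fin n) (Fin n ⊕ Fin n) ℂ)
    (G : Matrix (Fin n ⊕ Fin n) (Fin m ⊕ Fin m) ℂ)
    (H : Matrix (Fin m ⊕ Fin m) (Fin n ⊕ Fin n) ℂ)
    (K : Matrix (Fin m ⊕ Fin m) (Fin m ⊕ Fin m) ℂ) : Prop :=
  ∀ s : ℂ, 0 ≤ s.re →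
    IsUnit (s • (1 : Matrix (Fin n ⊕ Fin n) (Fin n ⊕ Fin n) ℂ) - F) →
    IsUnit ((-(starRingEnd ℂ s)) • (1 : Matrix (Fin n ⊕ Fin n) (Fin n ⊕ Fin n) ℂ) - F) →
    transferFn F G H K s * Jmat m * (transferFn F G H K (-(starRingEnd ℂ s)))ᴴ = Jmat m

open Filter Topology

lemma tendsto_inv_ofReal_atTop_zero :
    Tendsto (fun s : ℝ => ((s : ℂ)⁻¹)) atTop (𝓝 0) := by
  have := (Complex.continuous_ofReal.tendsto 0).comp tendsto_inv_atTop_zero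
  simpa [Function.comp_def] using this

lemma tendsto_one_sub_inv_smul {N : Type*} [DecidableEq N] (A : Matrix N N ℂ) :
    Tendsto (fun s : ℝ => (1 : Matrix N N ℂ) - ((s : ℂ)⁻¹) • A) atTop (𝓝 1) := by
  simpa using tendsto_const_nhds.sub (tendsto_inv_ofReal_atTop_zero.smul_const A)

lemma smul_one_sub_eq_smul {N : Type*} [DecidableEq N] (A : Matrix N N ℂ) {s : ℝ} (hs : s ≠ 0) :
    (s : ℂ) • (1 : Matrix N N ℂ) - A = (s : ℂ) • (1 - ((s : ℂ)⁻¹) • A) := by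
  rw [smul_sub, smul_smul, mul_inv_cancel₀ (by exact_mod_cast hs), one_smul]

section Resolvent

variable {N M P Q : Type*} [Fintype N] [DecidableEq N] [Fintype Q] [DecidableEq Q]

/-- The resolvent of a matrix at a real point. -/
def realResolvent (A : Matrix N N ℂ) (s : ℝ) : Matrix N N ℂ :=
  ((s : ℂ) • (1 : Matrix N N ℂ) - A)⁻¹

lemma tendsto_det_one_sub_inv_smul (A : Matrix N N ℂ) :
    Tendsto (fun s : ℝ => ((1 : Matrix N N ℂ) - ((s : ℂ)⁻¹) • A).det) atTop (𝓝 1) := by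
  simpa [Function.comp_def] using
    ((continuous_id.matrix_det).tendsto (1 : Matrix N N ℂ)).comp (tendsto_one_sub_inv_smul A)

lemma eventually_isUnit_smul_one_sub (A : Matrix N N ℂ) :
    ∀ᶠ s : ℝ in atTop, IsUnit ((s : ℂ) • (1 : Matrix N N ℂ) - A) := by
  filter_upwards [(tendsto_det_one_sub_inv_smul A).eventually_ne one_ne_zero,
    eventually_ne_atTop 0] with s h hs
  rw [smul_one_sub_eq_smul A hs, Matrix.isUnit_iff_isUnit_det, Matrix.det_smul]
  exact (mul_ne_zero (pow_ne_zero _ (by exact_mod_cast hs)) h).isUnit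

lemma tendsto_smul_realResolvent (A : Matrix N N ℂ) :
    Tendsto (fun s : ℝ => (s : ℂ) • realResolvent A s) atTop (𝓝 1) := by
  have h1 := ((tendsto_det_one_sub_inv_smul A).inv₀ one_ne_zero).smul
    (((continuous_id.matrix_adjugate).tendsto (1 : Matrix N N ℂ)).comp
      (tendsto_one_sub_inv_smul A))
  simp only [id, Matrix.adjugate_one, inv_one, one_smul] at h1
  refine h1.congr' ?_
  filter_upwards [(tendsto_det_one_sub_inv_smul A).eventually_ne one_ne_zero,
    eventually_ne_atTop 0] with s h hs
  have hs' : (s : ℂ) ≠ 0 := by exact_mod_cast hs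
  have : Invertible (s : ℂ) := invertibleOfNonzero hs'
  rw [realResolvent, smul_one_sub_eq_smul A hs, Matrix.inv_smul _ _ h.isUnit, smul_smul,
    mul_invOf_self, one_smul, Matrix.inv_def, Ring.inverse_eq_inv']
  rfl

lemma tendsto_realResolvent (A : Matrix N N ℂ) :
    Tendsto (realResolvent A) atTop (𝓝 0) := by
  have h2 := tendsto_inv_ofReal_atTop_zero.smul (tendsto_smul_realResolvent A)
  rw [zero_smul] at h2
  refine h2.congr' ?_
  filter_upwards [eventually_ne_atTop 0] with s hs
  rw [smul_smul, inv_mul_cancel₀ (by exact_mod_cast hs), one_smul]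

lemma smul_realResolvent {A : Matrix N N ℂ} {s : ℝ}
    (h : IsUnit ((s : ℂ) • (1 : Matrix N N ℂ) - A)) :
    (s : ℂ) • realResolvent A s = 1 + A * realResolvent A s := by
  have := Matrix.mul_nonsing_inv _ ((Matrix.isUnit_iff_isUnit_det _).1 h)
  rw [Matrix.sub_mul, Matrix.smul_mul, Matrix.one_mul] at this
  rw [← this, realResolvent]
  abel

lemma tendsto_smul_mul_realResolvent_mul (C : Matrix P N ℂ) (A : Matrix N N ℂ)
    (B : Matrix N M ℂ) :
    Tendsto (fun s : ℝ => (s : ℂ) • (C * realResolvent A s * B)) atTop (𝓝 (C * B)) := by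
  have hc : Continuous fun X : Matrix N N ℂ => C * X * B := by fun_prop
  simpa [Function.comp_def] using (hc.tendsto 1).comp (tendsto_smul_realResolvent A)

/-- Two realizations whose strictly proper parts agree for large real `s` have the same
Markov parameters. -/
lemma markov_eq_of_eventually_eq {A : Matrix N N ℂ} {A' : Matrix Q Q ℂ}
    {B : Matrix N M ℂ} {B' : Matrix Q M ℂ} (k : ℕ) :
    ∀ {C : Matrix P N ℂ} {C' : Matrix P Q ℂ},
    (∀ᶠ s : ℝ in atTop, C * realResolvent A s * B = C' * realResolvent A' s * B') →
      C * A ^ k * B = C' * A' ^ k * B' := by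
  have base : ∀ {C : Matrix P N ℂ} {C' : Matrix P Q ℂ},
      (∀ᶠ s : ℝ in atTop, C * realResolvent A s * B = C' * realResolvent A' s * B') →
      C * B = C' * B' := by
    intro C C' h
    refine tendsto_nhds_unique (tendsto_smul_mul_realResolvent_mul C A B)
      ((tendsto_smul_mul_realResolvent_mul C' A' B').congr' ?_)
    filter_upwards [h] with s hs
    rw [hs]
  induction k with
  | zero => intro C C' h; simpa using base h
  | succ k ih =>
    intro C C' h
    rw [pow_succ', pow_succ', ← Matrix.mul_assoc, ← Matrix.mul_assoc]
    refine ih ?_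
    have h0 := base h
    filter_upwards [h, eventually_isUnit_smul_one_sub A, eventually_isUnit_smul_one_sub A']
      with s hs hA hA'
    have e1 : (s : ℂ) • (C * realResolvent A s * B)
        = C * B + C * A * realResolvent A s * B := by
      rw [← Matrix.smul_mul, ← Matrix.mul_smul, smul_realResolvent hA, Matrix.mul_add,
        Matrix.mul_one, Matrix.add_mul, ← Matrix.mul_assoc C A]
    have e2 : (s : ℂ) • (C' * realResolvent A' s * B')
        = C' * B' + C' * A' * realResolvent A' s * B' := by
      rw [← Matrix.smul_mul, ← Matrix.mul_smul, smul_realResolvent hA', Matrix.mul_add,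
        Matrix.mul_one, Matrix.add_mul, ← Matrix.mul_assoc C' A']
    rw [hs, e2, h0] at e1
    exact (add_left_cancel e1).symm

end Resolvent

section Observability

variable {N M Q : Type*} [Fintype N] [DecidableEq N] [Fintype M]

/-- Full column rank of the observability matrix gives a left inverse, written blockwise. -/
lemma exists_sum_mul_eq_one_of_rank_obsvMat {F : Matrix N N ℂ} {H : Matrix M N ℂ} {k : ℕ}
    (h : (obsvMat F H k).rank = Fintype.card N) :
    ∃ W : Fin k → Matrix N M ℂ, ∑ j, W j * (H * F ^ (j : ℕ)) = 1 := by
  classical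
  have hsurj : Function.Surjective (obsvMat F H k)ᵀ.mulVec := by
    rw [← Matrix.rank_transpose, Matrix.rank] at h
    have : LinearMap.range (obsvMat F H k)ᵀ.mulVecLin = ⊤ :=
      Submodule.eq_top_of_finrank_eq (by rw [h]; simp)
    exact LinearMap.range_eq_top.1 this
  obtain ⟨B, hB⟩ := Matrix.mulVec_surjective_iff_exists_right_inverse.1 hsurj
  refine ⟨fun j => Matrix.of fun a b => B (j, b) a, ?_⟩
  rw [← Matrix.transpose_one, ← hB, Matrix.transpose_mul, Matrix.transpose_transpose]
  ext a b
  simp only [Matrix.sum_apply, Matrix.mul_apply (N := obsvMat F H k), Fintype.sum_prod_type]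
  refine Finset.sum_congr rfl fun j _ => ?_
  rw [Matrix.mul_apply]
  rfl

lemma eq_zero_of_forall_mul_pow_mul_eq_zero {F : Matrix N N ℂ} {H : Matrix M N ℂ} {k : ℕ}
    {W : Fin k → Matrix N M ℂ} (hW : ∑ j, W j * (H * F ^ (j : ℕ)) = 1)
    {X : Matrix N Q ℂ} (hX : ∀ j : ℕ, H * F ^ j * X = 0) : X = 0 := by
  rw [← Matrix.one_mul X, ← hW, Matrix.sum_mul]
  refine Finset.sum_eq_zero fun j _ => ?_
  rw [Matrix.mul_assoc, hX, Matrix.mul_zero]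

/-- Output injection does not change the unobservable subspace. -/
lemma forall_mul_pow_mul_eq_zero_of_output_injection {F : Matrix N N ℂ} {H : Matrix M N ℂ}
    {E : Matrix N M ℂ} {X : Matrix N Q ℂ} (hX : ∀ j : ℕ, H * (F - E * H) ^ j * X = 0) (j : ℕ) :
    H * F ^ j * X = 0 := by
  have key : ∀ j : ℕ, F ^ j * X = (F - E * H) ^ j * X := by
    intro j
    induction j with
    | zero => simp
    | succ j ih =>
      have h := hX j
      rw [pow_succ', pow_succ', Matrix.mul_assoc, ih, Matrix.mul_assoc (F - E * H),
        Matrix.sub_mul, Matrix.mul_assoc E, ← Matrix.mul_assoc H, h, Matrix.mul_zero, sub_zero]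
  rw [Matrix.mul_assoc, key, ← Matrix.mul_assoc, hX]

end Observability

/-- Transfer between two realizations with equal Markov parameters, the first observable and
the second controllable. -/
lemma exists_intertwiner_of_markov_eq {N M P Q : Type*} [Fintype N] [DecidableEq N]
    [Fintype Q] [DecidableEq Q] [Fintype M]
    {A : Matrix N N ℂ} {B : Matrix N M ℂ} {C : Matrix P N ℂ}
    {A' : Matrix Q Q ℂ} {B' : Matrix Q M ℂ} {C' : Matrix P Q ℂ}
    (hmk : ∀ k : ℕ, C * A ^ k * B = C' * A' ^ k * B')
    (hobs : ∀ X : Matrix N Q ℂ, (∀ k : ℕ, C * A ^ k * X = 0) → X = 0)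
    (hobs' : ∀ X : Matrix N M ℂ, (∀ k : ℕ, C * A ^ k * X = 0) → X = 0)
    {r : ℕ} {R : Fin r → Matrix M Q ℂ} (hR : ∑ j : Fin r, A' ^ (j : ℕ) * B' * R j = 1) :
    ∃ T : Matrix N Q ℂ, C * T = C' ∧ T * B' = B ∧ A * T = T * A' := by
  have hT : ∀ k : ℕ, C * A ^ k * (∑ j : Fin r, A ^ (j : ℕ) * B * R j) = C' * A' ^ k := by
    intro k
    rw [← Matrix.mul_one (C' * A' ^ k), ← hR, Matrix.mul_sum, Matrix.mul_sum]
    refine Finset.sum_congr rfl fun j _ => ?_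
    have h := hmk (k + j)
    rw [pow_add, pow_add] at h
    have := congrArg (· * R j) h
    simpa only [Matrix.mul_assoc] using this
  refine ⟨∑ j : Fin r, A ^ (j : ℕ) * B * R j, by simpa using hT 0, ?_, ?_⟩
  · refine sub_eq_zero.1 (hobs' _ fun k => ?_)
    rw [Matrix.mul_sub, ← Matrix.mul_assoc, hT, hmk, sub_self]
  · refine sub_eq_zero.1 (hobs _ fun k => ?_)
    rw [Matrix.mul_sub, ← Matrix.mul_assoc, ← Matrix.mul_assoc, hT, Matrix.mul_assoc C,
      ← pow_succ, hT, pow_succ, Matrix.mul_assoc, sub_self]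

lemma conjTranspose_Jmat (k : ℕ) : (Jmat k)ᴴ = Jmat k := by
  simp [Jmat, Matrix.fromBlocks_conjTranspose]

lemma Jmat_mul_Jmat (k : ℕ) : Jmat k * Jmat k = 1 := by
  simp [Jmat, Matrix.fromBlocks_multiply]

section TransferFunction

variable {N M P : Type*} [Fintype N] [DecidableEq N]

lemma transferFn_ofReal (F : Matrix N N ℂ) (G : Matrix N M ℂ) (H : Matrix P N ℂ)
    (K : Matrix P M ℂ) (s : ℝ) :
    transferFn F G H K s = H * realResolvent F s * G + K := rfl

lemma conjTranspose_transferFn_neg_conj (F : Matrix N N ℂ) (G : Matrix N M ℂ)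
    (H : Matrix P N ℂ) (K : Matrix P M ℂ) (s : ℂ) :
    (transferFn F G H K (-(starRingEnd ℂ s)))ᴴ = transferFn (-Fᴴ) Hᴴ (-Gᴴ) Kᴴ s := by
  have h : ((-(starRingEnd ℂ s)) • (1 : Matrix N N ℂ) - F)ᴴ = -(s • 1 - -Fᴴ) := by
    simp [Matrix.conjTranspose_sub, Matrix.conjTranspose_smul]
    abel
  have hinv : ∀ X : Matrix N N ℂ, (-X)⁻¹ = -X⁻¹ := by
    intro X
    by_cases hX : IsUnit X.det
    · exact Matrix.inv_eq_left_inv (by simp [Matrix.nonsing_inv_mul _ hX])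
    · rw [Matrix.nonsing_inv_apply_not_isUnit _ hX, Matrix.nonsing_inv_apply_not_isUnit, neg_zero]
      rwa [← Matrix.isUnit_iff_isUnit_det, IsUnit.neg_iff, Matrix.isUnit_iff_isUnit_det]
  rw [transferFn, transferFn, Matrix.conjTranspose_add, Matrix.conjTranspose_mul,
    Matrix.conjTranspose_mul, Matrix.conjTranspose_nonsing_inv, h, hinv]
  simp [Matrix.mul_assoc]

lemma tendsto_transferFn (F : Matrix N N ℂ) (G : Matrix N M ℂ) (H : Matrix P N ℂ)
    (K : Matrix P M ℂ) :
    Tendsto (fun s : ℝ => transferFn F G H K s) atTop (𝓝 K) := by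
  have hc : Continuous fun X : Matrix N N ℂ => H * X * G + K := by fun_prop
  simpa [Function.comp_def, transferFn_ofReal] using (hc.tendsto 0).comp (tendsto_realResolvent F)

/-- The state-space formula for the inverse of a transfer function. -/
lemma transferFn_mul_transferFn_inverse [Fintype M] [DecidableEq M]
    {F : Matrix N N ℂ} {G : Matrix N M ℂ} {H : Matrix M N ℂ}
    {K L : Matrix M M ℂ} (hKL : K * L = 1) {s : ℂ}
    (hF : IsUnit (s • (1 : Matrix N N ℂ) - F))
    (hF' : IsUnit (s • (1 : Matrix N N ℂ) - (F - G * L * H))) :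
    transferFn F G H K s * transferFn (F - G * L * H) (G * L) (-(L * H)) L s = 1 := by
  have h1 := Matrix.nonsing_inv_mul _ ((Matrix.isUnit_iff_isUnit_det _).1 hF)
  have h2 := Matrix.mul_nonsing_inv _ ((Matrix.isUnit_iff_isUnit_det _).1 hF')
  unfold transferFn
  set Φ := (s • (1 : Matrix N N ℂ) - F)⁻¹
  set Ψ := (s • (1 : Matrix N N ℂ) - (F - G * L * H))⁻¹
  have key : Φ * (G * (L * (H * Ψ))) = Φ - Ψ := by
    have e : G * (L * (H * Ψ)) = (s • (1 : Matrix N N ℂ) - (F - G * L * H)) * Ψ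
        - (s • (1 : Matrix N N ℂ) - F) * Ψ := by
      rw [← Matrix.sub_mul]
      simp [Matrix.mul_assoc]
    rw [e, h2, Matrix.mul_sub, ← Matrix.mul_assoc, h1, Matrix.mul_one, Matrix.one_mul]
  have key2 : H * Φ * G * (L * H * Ψ * (G * L)) = H * (Φ - Ψ) * (G * L) := by
    rw [← key]
    simp only [Matrix.mul_assoc]
  have key3 : K * (L * H * Ψ * (G * L)) = H * Ψ * (G * L) := by
    simp only [← Matrix.mul_assoc, hKL, Matrix.one_mul]
  rw [Matrix.neg_mul, Matrix.neg_mul, Matrix.mul_add, Matrix.add_mul, Matrix.add_mul,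
    Matrix.mul_neg, Matrix.mul_neg, key2, key3, hKL, Matrix.mul_sub, Matrix.sub_mul,
    ← Matrix.mul_assoc (H * Φ)]
  simp only [Matrix.mul_assoc]
  abel

end TransferFunction

section Main

variable {n m : ℕ} {F : Matrix (Fin n ⊕ Fin n) (Fin n ⊕ Fin n) ℂ}
  {G : Matrix (Fin n ⊕ Fin n) (Fin m ⊕ Fin m) ℂ} {H : Matrix (Fin m ⊕ Fin m) (Fin n ⊕ Fin n) ℂ}
  {K : Matrix (Fin m ⊕ Fin m) (Fin m ⊕ Fin m) ℂ}

lemma isUnit_smul_one_sub_neg_conjTranspose {N : Type*} [Fintype N] [DecidableEq N]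
    {F : Matrix N N ℂ} {s : ℂ} :
    IsUnit (s • (1 : Matrix N N ℂ) - -Fᴴ) ↔
      IsUnit ((-(starRingEnd ℂ s)) • (1 : Matrix N N ℂ) - F) := by
  have h : s • (1 : Matrix N N ℂ) - -Fᴴ = -star ((-(starRingEnd ℂ s)) • (1 : Matrix N N ℂ) - F) := by
    simp [Matrix.star_eq_conjTranspose]
    abel
  rw [h, IsUnit.neg_iff, isUnit_star]

lemma dualJJUnitary_of_lyapunov {Θ : Matrix (Fin n ⊕ Fin n) (Fin n ⊕ Fin n) ℂ}
    (hK : K * Jmat m * Kᴴ = Jmat m) (hΘ : Θᴴ = Θ)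
    (hlyap : F * Θ + Θ * Fᴴ + G * Jmat m * Gᴴ = 0)
    (hout : K * Jmat m * Gᴴ + H * Θ = 0) : DualJJUnitary F G H K := by
  intro s _ h1 h2
  have h1' := Matrix.nonsing_inv_mul _ ((Matrix.isUnit_iff_isUnit_det _).1 h1)
  have h2' := Matrix.mul_nonsing_inv _ ((Matrix.isUnit_iff_isUnit_det _).1
    (isUnit_smul_one_sub_neg_conjTranspose.2 h2))
  rw [conjTranspose_transferFn_neg_conj]
  unfold transferFn
  set Φ := (s • (1 : Matrix (Fin n ⊕ Fin n) (Fin n ⊕ Fin n) ℂ) - F)⁻¹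
  set Ψ := (s • (1 : Matrix (Fin n ⊕ Fin n) (Fin n ⊕ Fin n) ℂ) - -Fᴴ)⁻¹
  have hout' : G * Jmat m * Kᴴ = -(Θ * Hᴴ) := by
    have := congrArg conjTranspose hout
    simp only [Matrix.conjTranspose_add, Matrix.conjTranspose_mul, conjTranspose_conjTranspose,
      conjTranspose_Jmat, hΘ, conjTranspose_zero] at this
    rw [Matrix.mul_assoc]
    exact eq_neg_of_add_eq_zero_left this
  have hG : G * Jmat m * Gᴴ = (s • 1 - F) * Θ - Θ * (s • 1 - -Fᴴ) := by
    rw [eq_neg_of_add_eq_zero_right hlyap]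
    simp [Matrix.sub_mul, Matrix.mul_add]
    abel
  have key : Φ * (G * Jmat m * Gᴴ) * Ψ = Θ * Ψ - Φ * Θ := by
    rw [hG, Matrix.mul_sub, Matrix.sub_mul, ← Matrix.mul_assoc, h1', Matrix.one_mul,
      ← Matrix.mul_assoc, Matrix.mul_assoc (Φ * Θ), h2', Matrix.mul_one]
  calc _ = K * Jmat m * Kᴴ + H * Φ * (G * Jmat m * Kᴴ) - K * Jmat m * Gᴴ * Ψ * Hᴴ
        - H * (Φ * (G * Jmat m * Gᴴ) * Ψ) * Hᴴ := by
        simp only [Matrix.add_mul, Matrix.mul_add, Matrix.neg_mul, Matrix.mul_neg,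
          Matrix.mul_assoc]
        abel
    _ = Jmat m := by
        rw [hK, hout', key, eq_neg_of_add_eq_zero_left hout]
        simp only [Matrix.sub_mul, Matrix.mul_sub, Matrix.neg_mul, Matrix.mul_neg,
          Matrix.mul_assoc]
        abel

lemma DualJJUnitary.eventually (h : DualJJUnitary F G H K) :
    ∀ᶠ s : ℝ in atTop,
      transferFn F G H K s * Jmat m * transferFn (-Fᴴ) Hᴴ (-Gᴴ) Kᴴ s = Jmat m := by
  filter_upwards [eventually_isUnit_smul_one_sub F, eventually_isUnit_smul_one_sub (-Fᴴ),
    eventually_ge_atTop 0] with s h1 h2 hs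
  rw [← conjTranspose_transferFn_neg_conj]
  exact h s (by simpa using hs) h1 (isUnit_smul_one_sub_neg_conjTranspose.1 h2)

lemma DualJJUnitary.feedthrough (h : DualJJUnitary F G H K) : K * Jmat m * Kᴴ = Jmat m := by
  have hl := ((tendsto_transferFn F G H K).mul
    (tendsto_const_nhds (x := Jmat m))).mul (tendsto_transferFn (-Fᴴ) Hᴴ (-Gᴴ) Kᴴ)
  exact tendsto_nhds_unique hl (tendsto_const_nhds.congr' (h.eventually.mono fun s hs => hs.symm))

lemma DualJJUnitary.markov_eq (h : DualJJUnitary F G H K) (k : ℕ) :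
    -(Jmat m * Kᴴ * Jmat m * H) * (F - G * (Jmat m * Kᴴ * Jmat m) * H) ^ k *
        (G * (Jmat m * Kᴴ * Jmat m)) =
      -(Jmat m * Gᴴ) * (-Fᴴ) ^ k * (Hᴴ * Jmat m) := by
  have hKL : K * (Jmat m * Kᴴ * Jmat m) = 1 := by
    rw [← Matrix.mul_assoc, ← Matrix.mul_assoc, h.feedthrough, Jmat_mul_Jmat]
  refine markov_eq_of_eventually_eq k ?_
  filter_upwards [h.eventually, eventually_isUnit_smul_one_sub F,
    eventually_isUnit_smul_one_sub (F - G * (Jmat m * Kᴴ * Jmat m) * H)] with s hs h1 h2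
  have e1 := transferFn_mul_transferFn_inverse hKL h1 h2
  have e2 : transferFn F G H K s * (Jmat m * transferFn (-Fᴴ) Hᴴ (-Gᴴ) Kᴴ s * Jmat m) = 1 := by
    rw [← Matrix.mul_assoc, ← Matrix.mul_assoc, hs, Jmat_mul_Jmat]
  have e3 := left_inv_eq_right_inv (mul_eq_one_comm.1 e1) e2
  rw [transferFn_ofReal, transferFn_ofReal, Matrix.mul_add, Matrix.add_mul] at e3
  rw [add_right_cancel e3]
  simp only [Matrix.mul_assoc, Matrix.neg_mul, Matrix.mul_neg]

lemma DualJJUnitary.exists_lyapunov (h : DualJJUnitary F G H K)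
    (hobsv : (obsvMat F H (2 * n)).rank = 2 * n) :
    ∃ Θ : Matrix (Fin n ⊕ Fin n) (Fin n ⊕ Fin n) ℂ, Θᴴ = Θ ∧
      F * Θ + Θ * Fᴴ + G * Jmat m * Gᴴ = 0 ∧ K * Jmat m * Gᴴ + H * Θ = 0 := by
  obtain ⟨W, hW⟩ := exists_sum_mul_eq_one_of_rank_obsvMat
    (F := F) (H := H) (k := 2 * n) (by rw [hobsv]; simp [two_mul])
  have hJ := Jmat_mul_Jmat m
  have hKL : K * (Jmat m * Kᴴ * Jmat m) = 1 := by
    rw [← Matrix.mul_assoc, ← Matrix.mul_assoc, h.feedthrough, hJ]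
  have hmk := h.markov_eq
  set L := Jmat m * Kᴴ * Jmat m with hL
  have hobs : ∀ {Q : Type} (X : Matrix (Fin n ⊕ Fin n) Q ℂ),
      (∀ k : ℕ, -(L * H) * (F - G * L * H) ^ k * X = 0) → X = 0 := by
    intro Q X hX
    refine eq_zero_of_forall_mul_pow_mul_eq_zero hW
      (forall_mul_pow_mul_eq_zero_of_output_injection (E := G * L) fun j => ?_)
    have := congrArg (fun Y => -(K * Y)) (hX j)
    simp only [Matrix.neg_mul, Matrix.mul_neg, neg_neg, Matrix.mul_zero, neg_zero] at this
    simpa only [← Matrix.mul_assoc, hKL, Matrix.one_mul] using this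
  have hR : ∑ j : Fin (2 * n),
      (-Fᴴ) ^ (j : ℕ) * (Hᴴ * Jmat m) * ((-1 : ℂ) ^ (j : ℕ) • (Jmat m * (W j)ᴴ)) = 1 := by
    rw [← Matrix.conjTranspose_one, ← hW, Matrix.conjTranspose_sum]
    refine Finset.sum_congr rfl fun j _ => ?_
    have e : (-Fᴴ) ^ (j : ℕ) = (-1 : ℂ) ^ (j : ℕ) • Fᴴ ^ (j : ℕ) := by
      rw [← smul_pow, neg_one_smul]
    rw [e, Matrix.smul_mul, Matrix.smul_mul, Matrix.mul_smul, smul_smul, ← mul_pow,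
      neg_one_mul, neg_neg, one_pow, one_smul, Matrix.conjTranspose_mul,
      Matrix.conjTranspose_mul, Matrix.conjTranspose_pow, ← Matrix.mul_assoc,
      ← Matrix.mul_assoc, Matrix.mul_assoc (Fᴴ ^ (j : ℕ) * Hᴴ), hJ, Matrix.mul_one]
  obtain ⟨T, hC, hB, hA⟩ := exists_intertwiner_of_markov_eq hmk hobs hobs hR
  have hHT : H * T = K * Jmat m * Gᴴ := by
    have := congrArg (fun Y => -(K * Y)) hC
    simp only [Matrix.neg_mul, Matrix.mul_neg, neg_neg] at this
    rwa [← Matrix.mul_assoc, ← Matrix.mul_assoc, hKL, Matrix.one_mul, ← Matrix.mul_assoc] at this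
  have hLH : L * (H * T) = Jmat m * Gᴴ := by
    rw [Matrix.neg_mul] at hC
    rw [← Matrix.mul_assoc]
    exact neg_injective hC
  have hlyap : F * T + T * Fᴴ = G * Jmat m * Gᴴ := by
    rw [Matrix.sub_mul, Matrix.mul_assoc (G * L), Matrix.mul_assoc G, hLH, Matrix.mul_neg,
      ← Matrix.mul_assoc, sub_eq_iff_eq_add] at hA
    rw [hA]
    abel
  have hTH : H * Tᴴ = K * Jmat m * Gᴴ := by
    have := congrArg (fun Y => (Y * Jmat m)ᴴ) hB
    simp only [hL, Matrix.mul_assoc, hJ, Matrix.mul_one] at this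
    simpa only [Matrix.conjTranspose_mul, Matrix.conjTranspose_conjTranspose,
      conjTranspose_Jmat] using this
  have hlyap' : F * Tᴴ + Tᴴ * Fᴴ = G * Jmat m * Gᴴ := by
    have := congrArg conjTranspose hlyap
    simp only [Matrix.conjTranspose_add, Matrix.conjTranspose_mul,
      Matrix.conjTranspose_conjTranspose, conjTranspose_Jmat] at this
    rw [add_comm, this, Matrix.mul_assoc]
  have hherm : Tᴴ = T := by
    have hFD : F * (Tᴴ - T) = (Tᴴ - T) * (-Fᴴ) := by
      rw [Matrix.mul_sub, eq_sub_of_add_eq hlyap, eq_sub_of_add_eq hlyap', Matrix.sub_mul,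
        Matrix.mul_neg, Matrix.mul_neg]
      abel
    have hpow : ∀ j : ℕ, F ^ j * (Tᴴ - T) = (Tᴴ - T) * (-Fᴴ) ^ j := fun j =>
      (SemiconjBy.pow_right (show SemiconjBy (Tᴴ - T) (-Fᴴ) F from hFD.symm) j).symm
    refine sub_eq_zero.1 (eq_zero_of_forall_mul_pow_mul_eq_zero hW fun j => ?_)
    rw [Matrix.mul_assoc, hpow, ← Matrix.mul_assoc, Matrix.mul_sub, hTH, hHT, sub_self,
      Matrix.zero_mul]
  refine ⟨-T, by rw [Matrix.conjTranspose_neg, hherm], ?_, ?_⟩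
  · rw [← hlyap, Matrix.mul_neg, Matrix.neg_mul]
    abel
  · rw [Matrix.mul_neg, hHT, add_neg_cancel]

end Main

/-- for a minimal realization, the transfer function is dual `(J,J)`-unitary
iff `K J_m K† = J_m` and there is a Hermitian `Θ` with `FΘ + ΘF† + G J_m G† = 0` and
`K J_m G† + HΘ = 0`. -/
theorem stmt4 (n m : ℕ) (hn : 0 < n) (hm : 0 < m)
    (F : Matrix (Fin n ⊕ Fin n) (Fin n ⊕ Fin n) ℂ)
    (G : Matrix (Fin n ⊕ Fin n) (Fin m ⊕ Fin m) ℂ)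
    (H : Matrix (Fin m ⊕ Fin m) (Fin n ⊕ Fin n) ℂ)
    (K : Matrix (Fin m ⊕ Fin m) (Fin m ⊕ Fin m) ℂ)
    (hctrb : (ctrbMat F G (2 * n)).rank = 2 * n)
    (hobsv : (obsvMat F H (2 * n)).rank = 2 * n) :
    DualJJUnitary F G H K ↔
      K * Jmat m * Kᴴ = Jmat m ∧
      ∃ Θ : Matrix (Fin n ⊕ Fin n) (Fin n ⊕ Fin n) ℂ, Θᴴ = Θ ∧
        F * Θ + Θ * Fᴴ + G * Jmat m * Gᴴ = 0 ∧
        K * Jmat m * Gᴴ + H * Θ = 0 := by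
  constructor
  · exact fun h => ⟨h.feedthrough, h.exists_lyapunov hobsv⟩
  · rintro ⟨hK, Θ, hΘ, hlyap, hout⟩
    exact dualJJUnitary_of_lyapunov hK hΘ hlyap hout
end
end

section
/- Let K ∈ ℂ^{2m×2m} be doubled-up (KΣ_m = Σ_m K^#), and set D := Φ_m K Φ_m^{−1}, where Φ_m := [[I_m, I_m],[−iI_m, iI_m]]. Then D has real entries, and the pair of conditions (D D^T = I_{2m} and D J̃_m D^T = J̃_m) holds if and only if the pair of conditions (K K† = I_{2m} and K J_m K† = J_m) holds. -/
open Matrix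

noncomputable section

/-- `Σ_k = [[0, I],[I, 0]]`. -/
def SigmaMat (k : ℕ) : Matrix (Fin k ⊕ Fin k) (Fin k ⊕ Fin k) ℂ :=
  Matrix.fromBlocks 0 1 1 0

/-- `J̃_k = [[0, I],[−I, 0]]`, regarded as a complex matrix. -/
def JtC (k : ℕ) : Matrix (Fin k ⊕ Fin k) (Fin k ⊕ Fin k) ℂ :=
  Matrix.fromBlocks 0 1 (-1) 0

/-- `Φ_k = [[I, I],[−iI, iI]]`. -/
def Phi (k : ℕ) : Matrix (Fin k ⊕ Fin k) (Fin k ⊕ Fin k) ℂ :=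
  Matrix.fromBlocks 1 1 (-(Complex.I • 1)) (Complex.I • 1)

/-- Entrywise complex conjugate of a matrix. -/
def conjMat {α β : Type*} (R : Matrix α β ℂ) : Matrix α β ℂ :=
  R.map (starRingEnd ℂ)

/-- `R ∈ ℂ^{2n×2m}` is doubled-up if `R Σ_m = Σ_n R^#`. -/
def DoubledUp {n m : ℕ} (R : Matrix (Fin n ⊕ Fin n) (Fin m ⊕ Fin m) ℂ) : Prop :=
  R * SigmaMat m = SigmaMat n * conjMat R

/-- A complex matrix has real entries if every entry has zero imaginary part. -/
def HasRealEntries {α β : Type*} (R : Matrix α β ℂ) : Prop :=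
  ∀ i j, (R i j).im = 0

theorem conjTranspose_Phi (k : ℕ) :
    (Phi k)ᴴ = Matrix.fromBlocks 1 (Complex.I • 1) 1 (-(Complex.I • 1)) := by
  simp [Phi, Matrix.fromBlocks_conjTranspose]

theorem Phi_mul_conjTranspose (k : ℕ) : Phi k * 1 * (Phi k)ᴴ = (2 : ℂ) • 1 := by
  rw [conjTranspose_Phi, Phi, mul_one, Matrix.fromBlocks_multiply, ← Matrix.fromBlocks_one,
    Matrix.fromBlocks_smul]
  congr 1 <;> simp [smul_smul, two_smul]

theorem Phi_mul_Jmat_mul_conjTranspose (k : ℕ) :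
    Phi k * Jmat k * (Phi k)ᴴ = (2 * Complex.I) • JtC k := by
  rw [conjTranspose_Phi, Phi, Jmat, JtC, Matrix.fromBlocks_multiply, Matrix.fromBlocks_multiply,
    Matrix.fromBlocks_smul]
  congr 1 <;> simp [smul_smul, two_mul, add_smul]

theorem isUnit_Phi (k : ℕ) : IsUnit (Phi k) := by
  refine IsUnit.of_mul_eq_one ((2 : ℂ)⁻¹ • (Phi k)ᴴ) ?_
  have h := Phi_mul_conjTranspose k
  rw [mul_one] at h
  rw [Matrix.mul_smul, h, smul_smul]
  simp

theorem SigmaMat_mul_self (k : ℕ) : SigmaMat k * SigmaMat k = 1 := by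
  simp [SigmaMat, Matrix.fromBlocks_multiply]

theorem conjMat_Phi (k : ℕ) : conjMat (Phi k) = Phi k * SigmaMat k := by
  rw [Phi, SigmaMat, conjMat, Matrix.fromBlocks_multiply, Matrix.fromBlocks_map]
  congr 1
  all_goals
    ext i j
    by_cases h : i = j <;> simp [h]

theorem conjMat_mul {α β γ : Type*} [Fintype β] (A : Matrix α β ℂ) (B : Matrix β γ ℂ) :
    conjMat (A * B) = conjMat A * conjMat B :=
  Matrix.map_mul

/-- A matrix that `Phi` intertwines with a doubled-up matrix equals its entrywise conjugate. -/
theorem conjMat_eq_self_of_mul_Phi {m : ℕ} {D K : Matrix (Fin m ⊕ Fin m) (Fin m ⊕ Fin m) ℂ}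
    (hK : K * SigmaMat m = SigmaMat m * conjMat K) (hD : D * Phi m = Phi m * K) :
    conjMat D = D := by
  have hu : IsUnit (Phi m * SigmaMat m) :=
    (isUnit_Phi m).mul (IsUnit.of_mul_eq_one _ (SigmaMat_mul_self m))
  have h := congrArg conjMat hD
  rw [conjMat_mul, conjMat_mul, conjMat_Phi] at h
  refine hu.mul_left_inj.mp ?_
  rw [h, Matrix.mul_assoc, ← hK, ← Matrix.mul_assoc, ← hD, Matrix.mul_assoc]

/-- If `P` is invertible and intertwines `D` with `K`, then `D` preserves a scaled congruence
transform `Y` of `X` under `P` exactly when `K` preserves `X`. -/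
theorem mul_mul_conjTranspose_eq_self_iff {n : Type*} [Fintype n] [DecidableEq n]
    {P D K X Y : Matrix n n ℂ} {c : ℂ} (hc : c ≠ 0) (hP : IsUnit P) (hD : D * P = P * K)
    (hXY : P * X * Pᴴ = c • Y) : D * Y * Dᴴ = Y ↔ K * X * Kᴴ = X := by
  have hP' : IsUnit Pᴴ := hP.star
  have key : c • (D * Y * Dᴴ) = P * (K * X * Kᴴ) * Pᴴ := by
    calc c • (D * Y * Dᴴ) = D * (c • Y) * Dᴴ := by
          rw [Matrix.mul_smul, Matrix.smul_mul]
      _ = (D * P) * X * (D * P)ᴴ := by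
          rw [← hXY, Matrix.conjTranspose_mul]; simp only [Matrix.mul_assoc]
      _ = P * (K * X * Kᴴ) * Pᴴ := by
          rw [hD, Matrix.conjTranspose_mul]; simp only [Matrix.mul_assoc]
  rw [← smul_right_inj hc, key, ← hXY, hP'.mul_left_inj, hP.mul_right_inj]

/-- for a doubled-up `K`, the matrix `D := Φ_m K Φ_m⁻¹` has real entries, and
(`DDᵀ = I` and `D J̃_m Dᵀ = J̃_m`) holds iff (`KK† = I` and `K J_m K† = J_m`) holds. -/
theorem stmt12 (m : ℕ) (hm : 0 < m)
    (K : Matrix (Fin m ⊕ Fin m) (Fin m ⊕ Fin m) ℂ)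
    (hK : K * SigmaMat m = SigmaMat m * conjMat K) :
    HasRealEntries (Phi m * K * (Phi m)⁻¹) ∧
      ((Phi m * K * (Phi m)⁻¹) * (Phi m * K * (Phi m)⁻¹)ᵀ = 1 ∧
        (Phi m * K * (Phi m)⁻¹) * JtC m * (Phi m * K * (Phi m)⁻¹)ᵀ = JtC m ↔
       K * Kᴴ = 1 ∧ K * Jmat m * Kᴴ = Jmat m) := by
  have hP := isUnit_Phi m
  have hD : Phi m * K * (Phi m)⁻¹ * Phi m = Phi m * K :=
    Matrix.nonsing_inv_mul_cancel_right _ _ ((Matrix.isUnit_iff_isUnit_det _).mp hP)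
  generalize Phi m * K * (Phi m)⁻¹ = D at hD ⊢
  have hreal := conjMat_eq_self_of_mul_Phi hK hD
  have hT : Dᵀ = Dᴴ := congrArg Matrix.transpose hreal.symm
  refine ⟨fun i j => Complex.conj_eq_iff_im.mp (congrFun₂ hreal i j), ?_⟩
  rw [hT]
  refine and_congr ?_ ?_
  · simpa only [mul_one] using
      mul_mul_conjTranspose_eq_self_iff two_ne_zero hP hD (Phi_mul_conjTranspose m)
  · exact mul_mul_conjTranspose_eq_self_iff (mul_ne_zero two_ne_zero Complex.I_ne_zero) hP hD
      (Phi_mul_Jmat_mul_conjTranspose m)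
end
end
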